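/- arXiv:2308.01632 — 7 statements merged into one kernel-verified Lean document; each statement's English description precedes it below -/
import Mathlib

section
/- Let R be an integral domain of characteristic zero and let τ₁, …, τₙ be elements of R. Then for every real ε > 0 and every natural number N, there exists a finite subset S ⊆ R with |S| ≥ N such that the set Z = ⋃_{1 ≤ i, j ≤ n} {τᵢ·s + τⱼ·t : s, t ∈ S} satisfies |Z| ≤ |S|^(1+ε). -/
open MvPolynomial in
/-- A finite set of values `p(τ)` of polynomials `p` in `n` variables with natural coefficients
below `M` and total degree at most `l` has at most `M ^ (l + 1) ^ n` elements. -/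
theorem card_le_of_forall_exists_aeval {R : Type*} [CommRing R] {n : ℕ} (τ : Fin n → R)
    {S : Finset R} {l M : ℕ}
    (hS : ∀ x ∈ S, ∃ p : MvPolynomial (Fin n) ℕ,
      p.totalDegree ≤ l ∧ (∀ a, p.coeff a < M) ∧ aeval τ p = x) :
    S.card ≤ M ^ (l + 1) ^ n := by
  classical
  choose! p hdeg hcoeff heval using hS
  let code : S → (Fin n → Fin (l + 1)) → Fin M := fun x a =>
    ⟨(p x).coeff (Finsupp.equivFunOnFinite.symm fun i => (a i : ℕ)), hcoeff x x.2 _⟩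
  have hinj : Function.Injective code := by
    intro x y hxy
    have hp : p x = p y := by
      ext a
      by_cases ha : ∀ i, a i ≤ l
      · have := congrArg Fin.val (congrFun hxy fun i => ⟨a i, Nat.lt_succ_of_le (ha i)⟩)
        have hcast : (Finsupp.equivFunOnFinite.symm fun i => a i) = a := by
          ext i; simp
        simpa [code, hcast] using this
      · obtain ⟨i, hi⟩ := not_forall.mp ha
        have hzero : ∀ z ∈ S, (p z).coeff a = 0 := by
          intro z hz
          by_contra hne
          have h1 := le_totalDegree (mem_support_iff.mpr hne)
          have h2 : a i ≤ a.sum fun _ e => e := by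
            rw [Finsupp.sum_fintype _ _ fun _ => rfl]
            exact Finset.single_le_sum (f := fun i => a i) (fun _ _ => Nat.zero_le _)
              (Finset.mem_univ i)
          have := hdeg z hz
          omega
        rw [hzero x x.2, hzero y y.2]
    exact Subtype.ext (by rw [← heval x x.2, hp, heval y y.2])
  simpa using Fintype.card_le_of_injective code hinj

open MvPolynomial in
/-- If `s` and `t` are values at `τ` of polynomials of degree at most `l` with coefficients
below `M`, then `τ i * s + τ j * t` is the value of one of degree at most `l + 1` with
coefficients below `2 * M`. -/
theorem exists_aeval_eq_mul_add_mul {R : Type*} [CommRing R] {n : ℕ} (τ : Fin n → R)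
    {l M : ℕ} (i j : Fin n) {p q : MvPolynomial (Fin n) ℕ}
    (hp : p.totalDegree ≤ l) (hq : q.totalDegree ≤ l)
    (hpM : ∀ a, p.coeff a < M) (hqM : ∀ a, q.coeff a < M) :
    ∃ r : MvPolynomial (Fin n) ℕ, r.totalDegree ≤ l + 1 ∧ (∀ a, r.coeff a < 2 * M) ∧
      aeval τ r = τ i * aeval τ p + τ j * aeval τ q := by
  classical
  refine ⟨X i * p + X j * q, ?_, ?_, by simp⟩
  · have hX : ∀ (k : Fin n) (f : MvPolynomial (Fin n) ℕ), f.totalDegree ≤ l →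
        (X k * f).totalDegree ≤ l + 1 := by
      intro k f hf
      have h := totalDegree_mul (X k) f
      rw [totalDegree_X] at h
      omega
    exact (totalDegree_add _ _).trans (max_le (hX i p hp) (hX j q hq))
  · have hX : ∀ (k : Fin n) (f : MvPolynomial (Fin n) ℕ), (∀ a, f.coeff a < M) →
        ∀ a, (X k * f).coeff a < M := by
      intro k f hf a
      rw [coeff_X_mul']
      split_ifs
      · exact hf _
      · exact (Nat.zero_le _).trans_lt (hf 0)
    intro a
    have h1 := hX i p hpM a
    have h2 := hX j q hqM a
    rw [coeff_add]
    omega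

/-- A power with base greater than one eventually exceeds any polynomial. -/
theorem exists_succ_pow_lt_pow {r : ℝ} (hr : 1 < r) (k : ℕ) :
    ∃ l : ℕ, ((l : ℝ) + 1) ^ k < r ^ l := by
  have h0 : 0 < r := by linarith
  have h := (tendsto_pow_const_div_const_pow_of_one_lt k hr).comp (Filter.tendsto_add_atTop_nat 1)
  obtain ⟨l, hl⟩ := (h.eventually_lt_const (inv_pos.mpr h0)).exists
  refine ⟨l, ?_⟩
  simp only [Function.comp_apply, Nat.cast_add, Nat.cast_one] at hl
  rw [div_lt_iff₀ (by positivity), pow_succ' r, inv_mul_cancel_left₀ h0.ne'] at hl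
  exact hl

/-- Lemma 5.14: in an integral domain of characteristic zero, given elements
`τ₁, …, τₙ`, for every `ε > 0` and every `N` there is a finite set `S` with
`|S| ≥ N` such that `Z = ⋃_{i,j} τᵢ·S + τⱼ·S` has `|Z| ≤ |S|^(1+ε)`. -/
theorem small_expansion_in_integral_domain
    (R : Type*) [CommRing R] [IsDomain R] [CharZero R] [DecidableEq R]
    (n : ℕ) (τ : Fin n → R) (ε : ℝ) (hε : 0 < ε) (N : ℕ) :
    ∃ S : Finset R, N ≤ S.card ∧
      ((Finset.image
          (fun q : (Fin n × Fin n) × R × R => τ q.1.1 * q.2.1 + τ q.1.2 * q.2.2)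
          ((Finset.univ : Finset (Fin n × Fin n)) ×ˢ S ×ˢ S)).card : ℝ)
        ≤ (S.card : ℝ) ^ ((1 : ℝ) + ε) := by
  by_contra! hcon
  let Z : Finset R → Finset R := fun S => Finset.image
    (fun q : (Fin n × Fin n) × R × R => τ q.1.1 * q.2.1 + τ q.1.2 * q.2.2)
    ((Finset.univ : Finset (Fin n × Fin n)) ×ˢ S ×ˢ S)
  let S₀ : Finset R := (Finset.range (2 ^ (N + 1))).image (fun k : ℕ => (k : R))
  have hS₀ : S₀.card = 2 ^ (N + 1) := by
    rw [Finset.card_image_of_injective _ Nat.cast_injective, Finset.card_range]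
  have hN : N ≤ 2 ^ (N + 1) := (Nat.le_succ N).trans Nat.lt_two_pow_self.le
  have hlower : ∀ l : ℕ, N ≤ (Z^[l] S₀).card ∧
      (2 : ℝ) ^ (((N : ℝ) + 1) * (1 + ε) ^ l) ≤ ((Z^[l] S₀).card : ℝ) := by
    intro l
    induction l with
    | zero =>
      refine ⟨by simpa [hS₀] using hN, ?_⟩
      rw [Function.iterate_zero_apply, hS₀, pow_zero, mul_one]
      push_cast
      rw [← Real.rpow_natCast]
      push_cast
      exact le_rfl
    | succ l ih =>
      obtain ⟨ihN, ih⟩ := ih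
      rw [Function.iterate_succ_apply']
      have hgrow : ((Z^[l] S₀).card : ℝ) ^ (1 + ε) < ((Z (Z^[l] S₀)).card : ℝ) := hcon _ ihN
      have hone : (1 : ℝ) ≤ ((Z^[l] S₀).card : ℝ) :=
        (Real.one_le_rpow one_le_two (by positivity)).trans ih
      constructor
      · have h := (Real.self_le_rpow_of_one_le hone (by linarith : (1 : ℝ) ≤ 1 + ε)).trans hgrow.le
        exact ihN.trans (by exact_mod_cast h)
      · refine le_trans ?_ hgrow.le
        rw [pow_succ, ← mul_assoc, Real.rpow_mul zero_le_two]
        exact Real.rpow_le_rpow (by positivity) ih (by linarith)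
  have hpoly : ∀ l : ℕ, ∀ x ∈ Z^[l] S₀, ∃ p : MvPolynomial (Fin n) ℕ,
      p.totalDegree ≤ l ∧ (∀ a, p.coeff a < 2 ^ (N + 1 + l)) ∧ MvPolynomial.aeval τ p = x := by
    intro l
    induction l with
    | zero =>
      intro x hx
      obtain ⟨k, hk, rfl⟩ := Finset.mem_image.mp hx
      refine ⟨MvPolynomial.C k, (MvPolynomial.totalDegree_C k).le, fun a => ?_, by simp⟩
      rw [MvPolynomial.coeff_C]
      split_ifs
      · exact Finset.mem_range.mp hk
      · positivity
    | succ l ih =>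
      intro x hx
      rw [Function.iterate_succ_apply'] at hx
      obtain ⟨⟨⟨i, j⟩, s, t⟩, hst, rfl⟩ := Finset.mem_image.mp hx
      simp only [Finset.mem_product, Finset.mem_univ, true_and] at hst
      obtain ⟨p, hp, hpM, rfl⟩ := ih s hst.1
      obtain ⟨q, hq, hqM, rfl⟩ := ih t hst.2
      have hexp : 2 ^ (N + 1 + (l + 1)) = 2 * 2 ^ (N + 1 + l) := by ring
      rw [hexp]
      exact exists_aeval_eq_mul_add_mul τ i j hp hq hpM hqM
  obtain ⟨l, hl⟩ := exists_succ_pow_lt_pow (by linarith : 1 < 1 + ε) (n + 1)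
  have hupper := card_le_of_forall_exists_aeval τ (hpoly l)
  have hle : (2 : ℝ) ^ (((N : ℝ) + 1) * (1 + ε) ^ l) ≤
      (2 : ℝ) ^ (((N : ℝ) + 1 + l) * ((l : ℝ) + 1) ^ n) := by
    refine ((hlower l).2.trans (Nat.cast_le.mpr hupper)).trans_eq ?_
    push_cast
    rw [← pow_mul, ← Real.rpow_natCast]
    push_cast
    rfl
  rw [Real.rpow_le_rpow_left_iff one_lt_two] at hle
  have hmul : ((N : ℝ) + 1 + l) * ((l : ℝ) + 1) ^ n ≤ ((N : ℝ) + 1) * ((l : ℝ) + 1) ^ (n + 1) := by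
    rw [pow_succ', ← mul_assoc]
    have : (0 : ℝ) ≤ (N : ℝ) * l := by positivity
    gcongr
    linarith
  have hlt := mul_lt_mul_of_pos_left hl (by positivity : (0 : ℝ) < (N : ℝ) + 1)
  linarith
end

section
/- Let f and g be nonconstant polynomials in one variable over ℂ such that f and the composition f ∘ g have the same set of roots. If g has degree at least 2, then f has exactly one root in ℂ. -/
open Polynomial in
/-- A polynomial over an algebraically closed field with at most one root `t` is a multiple of
a power of `X - t`. -/
theorem Polynomial.eq_C_mul_X_sub_C_pow_of_unique_root {K : Type*} [Field K] [IsAlgClosed K]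
    {p : K[X]} (hp : p ≠ 0) {t : K} (ht : ∀ a, p.eval a = 0 → a = t) :
    p = C p.leadingCoeff * (X - C t) ^ p.natDegree := by
  have hs : p.Splits := IsAlgClosed.splits p
  have hr : p.roots = Multiset.replicate p.natDegree t :=
    Multiset.eq_replicate.2 ⟨hs.natDegree_eq_card_roots.symm,
      fun b hb => ht b ((mem_roots hp).1 hb)⟩
  conv_lhs => rw [hs.eq_prod_roots, hr]
  simp

open Polynomial in
/-- If `p` has degree at least two and at most one preimage `t` of `s`, then `t` is the only
critical point of `p`. -/
theorem Polynomial.eval_derivative_eq_zero_iff_of_unique_preimage {K : Type*} [Field K]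
    [IsAlgClosed K] [CharZero K] {p : K[X]} (hp : 2 ≤ p.natDegree) {s t : K}
    (ht : ∀ a, p.eval a = s → a = t) (a : K) :
    p.derivative.eval a = 0 ↔ a = t := by
  have hd : (p - C s).natDegree = p.natDegree := natDegree_sub_C
  have h0 : p - C s ≠ 0 := by
    intro h
    simp only [h, natDegree_zero] at hd
    omega
  have hform := eq_C_mul_X_sub_C_pow_of_unique_root h0 (t := t)
    fun b hb => ht b (by simpa [sub_eq_zero] using hb)
  have hder : p.derivative = (p - C s).derivative := by simp
  have hlc : (p - C s).leadingCoeff ≠ 0 := leadingCoeff_ne_zero.2 h0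
  rw [hder, hform, hd, derivative_C_mul, derivative_X_sub_C_pow]
  simp only [eval_mul, eval_C, eval_pow, eval_sub, eval_X, mul_eq_zero, hlc,
    false_or, Nat.cast_eq_zero, pow_eq_zero_iff (show p.natDegree - 1 ≠ 0 by omega), sub_eq_zero]
  exact or_iff_right (by omega)

/-- Lemma 6.7(1): if `f` and `f ∘ g` have the same roots and `deg g ≥ 2`,
then `f` has exactly one root. -/
theorem unique_root_of_same_roots_comp
    (f g : Polynomial ℂ) (hf : 0 < f.natDegree) (hg : 2 ≤ g.natDegree)
    (h : {a : ℂ | f.eval a = 0} = {a : ℂ | f.eval (g.eval a) = 0}) :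
    ∃! r : ℂ, f.eval r = 0 := by
  have hroot : ∀ a, f.eval a = 0 ↔ f.eval (g.eval a) = 0 := fun a => Set.ext_iff.1 h a
  have hf0 : f ≠ 0 := by
    rintro rfl
    simp at hf
  have hfin : Finite {a : ℂ // f.eval a = 0} := Polynomial.finite_setOfPred_isRoot hf0
  have hgsurj : ∀ s, ∃ t, g.eval t = s :=
    IsAlgClosed.eval_surjective (by omega)
  let G : {a : ℂ // f.eval a = 0} → {a : ℂ // f.eval a = 0} :=
    fun a => ⟨g.eval a.1, (hroot a.1).1 a.2⟩
  have hsurj : Function.Surjective G := by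
    rintro ⟨s, hs⟩
    obtain ⟨t, rfl⟩ := hgsurj s
    exact ⟨⟨t, (hroot t).2 hs⟩, rfl⟩
  have hinj : Function.Injective G := Finite.injective_iff_surjective.2 hsurj
  have hpre : ∀ t, f.eval (g.eval t) = 0 → ∀ a, g.eval a = g.eval t → a = t := by
    intro t ht a ha
    have hEq : G ⟨a, (hroot a).2 (ha ▸ ht)⟩ = G ⟨t, (hroot t).2 ht⟩ := Subtype.ext ha
    exact congrArg Subtype.val (hinj hEq)
  obtain ⟨r, hr⟩ := IsAlgClosed.exists_root f
    (Polynomial.natDegree_pos_iff_degree_pos.1 hf).ne'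
  refine ⟨r, hr, fun s hs => ?_⟩
  have hcrit : ∀ t, f.eval t = 0 → ∀ a, g.derivative.eval a = 0 ↔ a = t := fun t ht =>
    Polynomial.eval_derivative_eq_zero_iff_of_unique_preimage hg (hpre t ((hroot t).1 ht))
  exact (hcrit r hr s).1 ((hcrit s hs s).2 rfl)
end

section
/- Let f and g be nonconstant polynomials in one variable over ℂ such that f and the composition f ∘ g have the same set of roots, and suppose f has a unique root r ∈ ℂ. Then there exists a nonzero constant a ∈ ℂ such that g(x) = a·(x − r)^d + r, where d = deg(g); in other words, g is a monomial twisted by r. -/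
open Polynomial in
/-- A split polynomial whose only possible root is `r` is a constant multiple of a power
of `X - r`. -/
theorem Polynomial.Splits.eq_C_mul_X_sub_C_pow {K : Type*} [Field K] {p : K[X]} {r : K}
    (hs : p.Splits) (hr : ∀ a ∈ p.roots, a = r) :
    p = C p.leadingCoeff * (X - C r) ^ p.natDegree := by
  have hroots : p.roots = Multiset.replicate p.natDegree r :=
    Multiset.eq_replicate.mpr ⟨hs.natDegree_eq_card_roots.symm, hr⟩
  conv_lhs => rw [hs.eq_prod_roots, hroots, Multiset.map_replicate, Multiset.prod_replicate]

/-- Lemma 6.7(2): if `f` and `f ∘ g` have the same roots and `f` has the unique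
root `r`, then `g` is a monomial twisted by `r`: `g(x) = a(x - r)^d + r` with
`a ≠ 0` and `d = deg g`. -/
theorem twisted_monomial_of_same_roots_comp
    (f g : Polynomial ℂ) (hf : 0 < f.natDegree) (hg : 0 < g.natDegree) (r : ℂ)
    (h : {a : ℂ | f.eval a = 0} = {a : ℂ | f.eval (g.eval a) = 0})
    (hr : {a : ℂ | f.eval a = 0} = {r}) :
    ∃ a : ℂ, a ≠ 0 ∧
      g = Polynomial.C a * (Polynomial.X - Polynomial.C r) ^ g.natDegree
            + Polynomial.C r := by
  have hdeg : (g - Polynomial.C r).natDegree = g.natDegree := Polynomial.natDegree_sub_C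
  have hne : g - Polynomial.C r ≠ 0 := Polynomial.ne_zero_of_natDegree_gt (hdeg ▸ hg)
  have hroot : ∀ a ∈ (g - Polynomial.C r).roots, a = r := by
    intro a ha
    have hga : g.eval a = r := by
      simpa [sub_eq_zero] using Polynomial.isRoot_of_mem_roots ha
    have hfr : f.eval r = 0 := hr.ge rfl
    have hfga : f.eval (g.eval a) = 0 := by rw [hga, hfr]
    exact hr.le (h.ge hfga)
  refine ⟨(g - Polynomial.C r).leadingCoeff, Polynomial.leadingCoeff_ne_zero.mpr hne, ?_⟩
  rw [← sub_eq_iff_eq_add, ← hdeg]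
  exact (IsAlgClosed.splits _).eq_C_mul_X_sub_C_pow hroot
end

section
/- Let g ∈ ℂ[x] be a nonconstant polynomial of degree d, and let R ⊆ ℂ be a nonempty finite set such that g(R) ⊆ R and g⁻¹(R) ⊆ R. Then g restricts to a bijection (permutation) of R, and for every r ∈ R there is a nonzero constant a ∈ ℂ such that g(x) = a·(x − r)^d + g(r). -/
/-- A polynomial over an algebraically closed field that takes the value `g(r)` only at `r` is,
up to an additive constant, a multiple of a power of `X - r`. -/
theorem Polynomial.eq_C_mul_X_sub_C_pow_add_C_of_eval_eq_imp_eq {k : Type*} [Field k]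
    [IsAlgClosed k] (g : Polynomial k) (r : k) (h : ∀ x, g.eval x = g.eval r → x = r)
    (hg : 0 < g.natDegree) :
    g = Polynomial.C g.leadingCoeff * (Polynomial.X - Polynomial.C r) ^ g.natDegree
      + Polynomial.C (g.eval r) := by
  have hlead : (g - C (g.eval r)).leadingCoeff = g.leadingCoeff :=
    leadingCoeff_sub_of_degree_lt (degree_C_le.trans_lt (natDegree_pos_iff_degree_pos.mp hg))
  have hsplits := IsAlgClosed.splits (g - C (g.eval r))
  have hroots : (g - C (g.eval r)).roots = Multiset.replicate g.natDegree r := by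
    refine Multiset.eq_replicate.mpr ⟨?_, fun x hx => h x ?_⟩
    · rw [← hsplits.natDegree_eq_card_roots, natDegree_sub_C]
    · simpa [sub_eq_zero] using (mem_roots'.mp hx).2
  have hprod := hsplits.eq_prod_roots
  rw [hroots, hlead, Multiset.map_replicate, Multiset.prod_replicate] at hprod
  exact sub_eq_iff_eq_add.mp hprod


/-- If `g` is a nonconstant complex polynomial of degree `d`, and `R ⊆ ℂ` is a
nonempty finite set with `g(R) ⊆ R` and `g⁻¹(R) ⊆ R`, then `g` restricts to a
permutation of `R`, and for every `r ∈ R` there is `a ≠ 0` with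
`g(x) = a(x - r)^d + g(r)`. -/
theorem permutation_and_twisted_form_of_invariant_root_set
    (g : Polynomial ℂ) (hg : 0 < g.natDegree) (R : Finset ℂ) (hR : R.Nonempty)
    (h1 : ∀ r ∈ R, g.eval r ∈ R) (h2 : ∀ x : ℂ, g.eval x ∈ R → x ∈ R) :
    Set.BijOn (fun x => g.eval x) ↑R ↑R ∧
    ∀ r ∈ R, ∃ a : ℂ, a ≠ 0 ∧
      g = Polynomial.C a * (Polynomial.X - Polynomial.C r) ^ g.natDegree
            + Polynomial.C (g.eval r) := by
  have hmaps : Set.MapsTo (fun x => g.eval x) (R : Set ℂ) R := fun r hr => h1 r hr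
  have hsurj : Set.SurjOn (fun x => g.eval x) (R : Set ℂ) R := by
    intro s hs
    obtain ⟨x, rfl⟩ := IsAlgClosed.eval_surjective hg.ne' s
    exact ⟨x, h2 x hs, rfl⟩
  have hinj : Set.InjOn (fun x => g.eval x) (R : Set ℂ) :=
    Finset.injOn_of_surjOn_of_card_le _ hmaps hsurj le_rfl
  refine ⟨⟨hmaps, hinj, hsurj⟩, fun r hr => ⟨g.leadingCoeff, ?_, ?_⟩⟩
  · exact Polynomial.leadingCoeff_ne_zero.mpr (Polynomial.ne_zero_of_natDegree_gt hg)
  · refine g.eq_C_mul_X_sub_C_pow_add_C_of_eval_eq_imp_eq r (fun x hx => ?_) hg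
    exact hinj (h2 x (hx ▸ h1 r hr)) hr hx
end

section
/- Let P be a polynomial in two variables over ℂ that has positive degree in x and positive degree in y, and suppose P(x, y) = f(u(x)·v(y)) for some univariate polynomials f, u, v ∈ ℂ[t]. Then for a ∈ ℂ, the univariate polynomial y ↦ P(a, y) is constant if and only if u(a) = 0, and for b ∈ ℂ, the univariate polynomial x ↦ P(x, b) is constant if and only if v(b) = 0. In particular, there exist a, b ∈ ℂ such that P is constant on the line x = a and constant on the line y = b. -/
namespace MvPolynomial

lemma degreeOf_eq_zero_of_eval_update_eq {σ R : Type*} [DecidableEq σ] [CommRing R] [IsDomain R]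
    [Infinite R] {p : MvPolynomial σ R} {i : σ}
    (h : ∀ z : σ → R, eval (Function.update z i 0) p = eval z p) : p.degreeOf i = 0 := by
  have hp : p = bind₁ (Function.update X i 0) p := by
    refine MvPolynomial.funext fun z ↦ ?_
    rw [← h z, ← coe_aeval_eq_eval, ← coe_aeval_eq_eval, RingHom.coe_coe, RingHom.coe_coe,
      aeval_bind₁]
    congr 2
    ext j
    by_cases hj : j = i
    · subst hj; simp
    · simp [hj]
  have hi : i ∉ p.vars := by
    intro hmem
    rw [hp] at hmem
    obtain ⟨j, -, hj⟩ := Finset.mem_biUnion.mp (vars_bind₁ _ _ hmem)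
    by_cases hji : j = i
    · subst hji; simp at hj
    · simp [hji, vars_X] at hj
      exact hji hj.symm
  rw [vars_def, Multiset.mem_toFinset] at hi
  rw [degreeOf_def, Multiset.count_eq_zero_of_notMem hi]

end MvPolynomial

namespace Polynomial

lemma natDegree_eq_zero_of_eval_eq {R : Type*} [CommRing R] [IsDomain R] [Infinite R] {p : R[X]}
    (h : ∀ x y : R, p.eval x = p.eval y) : p.natDegree = 0 := by
  have hp : p = C (p.eval 0) := Polynomial.funext fun x ↦ by rw [eval_C, h x 0]
  rw [hp, natDegree_C]

lemma eval_mul_eval_const_iff {R : Type*} [CommRing R] [IsDomain R] [Infinite R] {f v : R[X]}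
    (hf : f.natDegree ≠ 0) (hv : v.natDegree ≠ 0) (c : R) :
    (∀ y₁ y₂ : R, f.eval (c * v.eval y₁) = f.eval (c * v.eval y₂)) ↔ c = 0 := by
  refine ⟨fun h ↦ ?_, fun h ↦ by simp [h]⟩
  by_contra hc
  have hdeg : (f.comp (C c * v)).natDegree = 0 :=
    natDegree_eq_zero_of_eval_eq fun x y ↦ by simpa using h x y
  rw [natDegree_comp, natDegree_C_mul hc] at hdeg
  exact mul_ne_zero hf hv hdeg

lemma eval_eq_of_natDegree_eq_zero {R : Type*} [CommSemiring R] {p : R[X]} (h : p.natDegree = 0)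
    (x y : R) : p.eval x = p.eval y := by
  rw [eq_C_of_natDegree_eq_zero h, eval_C, eval_C]

end Polynomial

/-- Lemma 6.6(2): if `P(x,y) = f(u(x)·v(y))` for a bivariate polynomial `P`
depending on both variables, then `P` is constant on the line `x = a` iff
`u(a) = 0`, constant on the line `y = b` iff `v(b) = 0`; in particular `P` is
constant on at least one vertical and one horizontal line. -/
theorem weakly_multiplicative_constant_lines
    (P : MvPolynomial (Fin 2) ℂ)
    (hx : 0 < P.degreeOf 0) (hy : 0 < P.degreeOf 1)
    (f u v : Polynomial ℂ)
    (h : ∀ x y : ℂ, MvPolynomial.eval ![x, y] P = f.eval (u.eval x * v.eval y)) :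
    (∀ a : ℂ, (∀ y₁ y₂ : ℂ,
        MvPolynomial.eval ![a, y₁] P = MvPolynomial.eval ![a, y₂] P) ↔ u.eval a = 0) ∧
    (∀ b : ℂ, (∀ x₁ x₂ : ℂ,
        MvPolynomial.eval ![x₁, b] P = MvPolynomial.eval ![x₂, b] P) ↔ v.eval b = 0) ∧
    (∃ a b : ℂ,
      (∀ y₁ y₂ : ℂ, MvPolynomial.eval ![a, y₁] P = MvPolynomial.eval ![a, y₂] P) ∧
      (∀ x₁ x₂ : ℂ, MvPolynomial.eval ![x₁, b] P = MvPolynomial.eval ![x₂, b] P)) := by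
  have indep_left (hP : ∀ x y : ℂ, MvPolynomial.eval ![0, y] P = MvPolynomial.eval ![x, y] P) :
      False := by
    refine hx.ne' (MvPolynomial.degreeOf_eq_zero_of_eval_update_eq fun z ↦ ?_)
    convert hP (z 0) (z 1) using 2 <;> · congr 1; ext j; fin_cases j <;> simp
  have indep_right (hP : ∀ x y : ℂ, MvPolynomial.eval ![x, 0] P = MvPolynomial.eval ![x, y] P) :
      False := by
    refine hy.ne' (MvPolynomial.degreeOf_eq_zero_of_eval_update_eq fun z ↦ ?_)
    convert hP (z 0) (z 1) using 2 <;> · congr 1; ext j; fin_cases j <;> simp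
  have hf : f.natDegree ≠ 0 := fun h0 ↦ indep_left fun x y ↦ by
    rw [h, h, Polynomial.eval_eq_of_natDegree_eq_zero h0]
  have hu : u.natDegree ≠ 0 := fun h0 ↦ indep_left fun x y ↦ by
    rw [h, h, Polynomial.eval_eq_of_natDegree_eq_zero h0 0 x]
  have hv : v.natDegree ≠ 0 := fun h0 ↦ indep_right fun x y ↦ by
    rw [h, h, Polynomial.eval_eq_of_natDegree_eq_zero h0 0 y]
  have const_vertical (a : ℂ) : (∀ y₁ y₂ : ℂ,
      MvPolynomial.eval ![a, y₁] P = MvPolynomial.eval ![a, y₂] P) ↔ u.eval a = 0 := by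
    simpa only [h] using Polynomial.eval_mul_eval_const_iff hf hv (u.eval a)
  have const_horizontal (b : ℂ) : (∀ x₁ x₂ : ℂ,
      MvPolynomial.eval ![x₁, b] P = MvPolynomial.eval ![x₂, b] P) ↔ v.eval b = 0 := by
    simpa only [h, mul_comm] using Polynomial.eval_mul_eval_const_iff hf hu (v.eval b)
  obtain ⟨a, ha⟩ := IsAlgClosed.exists_root u fun h0 ↦
    hu (Polynomial.natDegree_eq_of_degree_eq_some h0)
  obtain ⟨b, hb⟩ := IsAlgClosed.exists_root v fun h0 ↦
    hv (Polynomial.natDegree_eq_of_degree_eq_some h0)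
  exact ⟨const_vertical, const_horizontal, a, b, (const_vertical a).2 ha, (const_horizontal b).2 hb⟩
end

section
/- Let P be a polynomial in two variables over ℂ that has positive degree in x and positive degree in y. Then P is not both weakly additive and weakly multiplicative: there cannot simultaneously exist nonconstant univariate polynomials f₁, u₁, v₁ ∈ ℂ[t] with P(x, y) = f₁(u₁(x) + v₁(y)) and nonconstant univariate polynomials f₂, u₂, v₂ ∈ ℂ[t] with P(x, y) = f₂(u₂(x)·v₂(y)). -/
/-- Lemma 6.6(3): a bivariate polynomial depending on both variables is not
both weakly additive and weakly multiplicative. -/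
theorem not_weakly_additive_and_multiplicative
    (P : MvPolynomial (Fin 2) ℂ)
    (hx : 0 < P.degreeOf 0) (hy : 0 < P.degreeOf 1) :
    ¬ ((∃ f u v : Polynomial ℂ,
          0 < f.natDegree ∧ 0 < u.natDegree ∧ 0 < v.natDegree ∧
          ∀ x y : ℂ, MvPolynomial.eval ![x, y] P = f.eval (u.eval x + v.eval y)) ∧
       (∃ f u v : Polynomial ℂ,
          0 < f.natDegree ∧ 0 < u.natDegree ∧ 0 < v.natDegree ∧
          ∀ x y : ℂ, MvPolynomial.eval ![x, y] P = f.eval (u.eval x * v.eval y))) := by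
  rintro ⟨⟨f, u, v, hf, hu, -, h⟩, g, a, b, -, -, hb, h'⟩
  obtain ⟨y, hby⟩ := Complex.exists_root (Polynomial.natDegree_pos_iff_degree_pos.mp hb)
  have hconst : f.comp (u + Polynomial.C (v.eval y)) = Polynomial.C (g.eval 0) := by
    refine Polynomial.funext fun x => ?_
    have := (h x y).symm.trans (h' x y)
    simpa [Polynomial.eval_comp, hby.eq_zero] using this
  have hdeg := congrArg Polynomial.natDegree hconst
  rw [Polynomial.natDegree_comp, Polynomial.natDegree_add_C, Polynomial.natDegree_C] at hdeg
  exact (Nat.mul_pos hf hu).ne' hdeg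
end

section
/- Let P be a polynomial in two variables over ℂ that has positive degree in x and positive degree in y. Suppose P(x, y) = g(v(x)·w(y)) and also P(x, y) = g'(v'(x)·w'(y)) for univariate polynomials g, v, w, g', v', w' ∈ ℂ[t]. Then v and v' have the same set of roots in ℂ, and w and w' have the same set of roots in ℂ. -/
/-- A polynomial whose values do not depend on the `i`-th coordinate has degree zero in `X i`. -/
theorem MvPolynomial.degreeOf_eq_zero_of_eval_update {σ R : Type*} [DecidableEq σ] [CommRing R]
    [IsDomain R] [Infinite R] (P : MvPolynomial σ R) (i : σ)
    (h : ∀ f : σ → R, eval (Function.update f i 0) P = eval f P) : P.degreeOf i = 0 := by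
  have key : bind₁ (Function.update X i 0) P = P := by
    refine MvPolynomial.funext fun f => ?_
    rw [← h f, ← coe_aeval_eq_eval, RingHom.coe_coe, aeval_bind₁, ← coe_aeval_eq_eval,
      RingHom.coe_coe]
    congr 2
    ext j
    by_cases hj : j = i
    · subst hj; simp
    · simp [hj]
  by_contra hne
  have hi : i ∈ P.vars := mem_vars_iff_degreeOf_ne_zero.mpr hne
  rw [← key] at hi
  obtain ⟨j, -, hj⟩ := mem_vars_bind₁ _ _ hi
  by_cases hji : j = i
  · subst hji; simp at hj
  · simp only [Function.update_of_ne hji, vars_X, Finset.mem_singleton] at hj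
    exact hji hj.symm

/-- If `y ↦ g (c * w y)` is constant with `c ≠ 0`, then `g` or `w` is constant. -/
theorem Polynomial.natDegree_eq_zero_of_eval_const_mul {R : Type*} [CommRing R] [IsDomain R]
    [Infinite R] {g w : Polynomial R} {c d : R} (hc : c ≠ 0)
    (h : ∀ y, g.eval (c * w.eval y) = d) : g.natDegree = 0 ∨ w.natDegree = 0 := by
  have key : g.comp (C c * w) = C d := Polynomial.funext fun y => by simp [h]
  have hdeg := congrArg natDegree key
  rwa [natDegree_comp, natDegree_C_mul hc, natDegree_C, mul_eq_zero] at hdeg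

/-- The roots of `v` are the `a` at which `y ↦ F a y = g (v a * w y)` is constant. -/
theorem Polynomial.eval_eq_zero_iff_of_eq_eval_mul {R : Type*} [CommRing R] [IsDomain R]
    [Infinite R] {F : R → R → R} {g v w : Polynomial R}
    (h : ∀ x y, F x y = g.eval (v.eval x * w.eval y)) (hF : ¬ ∀ x y, F x 0 = F x y) (a : R) :
    v.eval a = 0 ↔ ∃ d, ∀ y, F a y = d := by
  refine ⟨fun ha => ⟨g.eval 0, fun y => by rw [h, ha, zero_mul]⟩, ?_⟩
  rintro ⟨d, hd⟩
  by_contra ha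
  refine hF fun x y => ?_
  rw [h, h]
  rcases natDegree_eq_zero_of_eval_const_mul ha fun y => (h a y).symm.trans (hd y) with hg | hw
  · rw [eq_C_of_natDegree_eq_zero hg, eval_C, eval_C]
  · rw [eq_C_of_natDegree_eq_zero hw, eval_C, eval_C]

/-- Corollary 6.5(3): if a bivariate polynomial `P` depending on both variables
has two representations `P(x,y) = g(v(x)·w(y)) = g'(v'(x)·w'(y))`, then `v, v'`
have the same roots and `w, w'` have the same roots. -/
theorem multiplicative_inner_roots_intrinsic
    (P : MvPolynomial (Fin 2) ℂ)
    (hx : 0 < P.degreeOf 0) (hy : 0 < P.degreeOf 1)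
    (g v w g' v' w' : Polynomial ℂ)
    (h : ∀ x y : ℂ, MvPolynomial.eval ![x, y] P = g.eval (v.eval x * w.eval y))
    (h' : ∀ x y : ℂ, MvPolynomial.eval ![x, y] P = g'.eval (v'.eval x * w'.eval y)) :
    {a : ℂ | v.eval a = 0} = {a : ℂ | v'.eval a = 0} ∧
    {a : ℂ | w.eval a = 0} = {a : ℂ | w'.eval a = 0} := by
  have hF : ¬ ∀ x y : ℂ, MvPolynomial.eval ![x, 0] P = MvPolynomial.eval ![x, y] P := by
    refine fun hP => hy.ne' (P.degreeOf_eq_zero_of_eval_update 1 fun f => ?_)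
    convert hP (f 0) (f 1) using 2 <;> congr 1 <;> ext j <;> fin_cases j <;> simp
  have hG : ¬ ∀ y x : ℂ, MvPolynomial.eval ![0, y] P = MvPolynomial.eval ![x, y] P := by
    refine fun hP => hx.ne' (P.degreeOf_eq_zero_of_eval_update 0 fun f => ?_)
    convert hP (f 1) (f 0) using 2 <;> congr 1 <;> ext j <;> fin_cases j <;> simp
  constructor <;> ext a
  · exact (Polynomial.eval_eq_zero_iff_of_eq_eval_mul h hF a).trans
      (Polynomial.eval_eq_zero_iff_of_eq_eval_mul h' hF a).symm
  · exact (Polynomial.eval_eq_zero_iff_of_eq_eval_mul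
        (fun y x => (h x y).trans (by rw [mul_comm])) hG a).trans
      (Polynomial.eval_eq_zero_iff_of_eq_eval_mul
        (fun y x => (h' x y).trans (by rw [mul_comm])) hG a).symm
end
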